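/- Let n ≥ 1 and set h_q(w,y) = q·w − q^{−1}·y and h_1(w,y) = w − y, working in the field of rational functions ℚ(q)(w_1,…,w_n,y_1,…,y_n). Then the antisymmetrizer with respect to w_1,…,w_n of the rational function ∏_{1≤i<j≤n} h_q(w_i,w_j) / (∏_{1≤i≤j≤n} h_1(w_j,y_i) · ∏_{1≤j≤i≤n} h_q(w_j,y_i)) equals det_{1≤i,j≤n}( 1/(h_1(w_i,y_j)·h_q(w_i,y_j)) ) / ∏_{1≤i<j≤n} h_1(y_j,y_i). -/

import Mathlib

open scoped BigOperators

/-- The field of rational functions `ℚ(q)(w_1,…,w_n,y_1,…,y_n)`. -/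
noncomputable abbrev RF (n : ℕ) : Type :=
  FractionRing (MvPolynomial (Fin n ⊕ Fin n ⊕ Unit) ℚ)

/-- The variable `w_i`. -/
noncomputable def wv {n : ℕ} (i : Fin n) : RF n :=
  algebraMap (MvPolynomial (Fin n ⊕ Fin n ⊕ Unit) ℚ) (RF n) (MvPolynomial.X (Sum.inl i))

/-- The variable `y_i`. -/
noncomputable def yv {n : ℕ} (i : Fin n) : RF n :=
  algebraMap (MvPolynomial (Fin n ⊕ Fin n ⊕ Unit) ℚ) (RF n) (MvPolynomial.X (Sum.inr (Sum.inl i)))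

/-- The variable `q`. -/
noncomputable def qv {n : ℕ} : RF n :=
  algebraMap (MvPolynomial (Fin n ⊕ Fin n ⊕ Unit) ℚ) (RF n) (MvPolynomial.X (Sum.inr (Sum.inr ())))

/-- `h_q(w,y) = q w − q^{−1} y`. -/
noncomputable def hq {n : ℕ} (w y : RF n) : RF n := qv * w - qv⁻¹ * y

/-- `h_1(w,y) = w − y`. -/
noncomputable def h1 {n : ℕ} (w y : RF n) : RF n := w - y

/-- Partial fraction expansion of `∏ (x - w j) / ∏ (x - y j)`. -/
lemma prod_sub_mul_inv_eq_one_add_sum {K : Type*} [Field K] {n : ℕ} (w y : Fin n → K)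
    (hy : Function.Injective y) (x : K) (hx : ∀ j, x ≠ y j) :
    ∏ j, (x - w j) * (x - y j)⁻¹ =
      1 + ∑ j, (Lagrange.nodalWeight Finset.univ y j * ∏ i, (y j - w i)) * (x - y j)⁻¹ := by
  have hQ : ∏ j, (x - y j) ≠ 0 := Finset.prod_ne_zero_iff.2 fun j _ => sub_ne_zero.2 (hx j)
  have hdeg : (Lagrange.nodal Finset.univ w - Lagrange.nodal Finset.univ y).degree
      < (Finset.univ : Finset (Fin n)).card := by
    rw [← Lagrange.degree_nodal (s := Finset.univ) (v := w)]
    refine Polynomial.degree_sub_lt_left ?_ Lagrange.nodal_ne_zero ?_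
    · simp [Lagrange.degree_nodal]
    · rw [Lagrange.nodal_monic.leadingCoeff, Lagrange.nodal_monic.leadingCoeff]
  have h := congrArg (Polynomial.eval x)
    (Lagrange.eq_interpolate (s := Finset.univ) (v := y) hy.injOn hdeg)
  rw [Lagrange.eval_interpolate_not_at_node _ (fun j _ => hx j)] at h
  simp only [Polynomial.eval_sub, Lagrange.eval_nodal] at h
  have hsum : ∑ j, Lagrange.nodalWeight Finset.univ y j * (x - y j)⁻¹ *
      (∏ i, (y j - w i) - ∏ i, (y j - y i)) =
      ∑ j, (Lagrange.nodalWeight Finset.univ y j * ∏ i, (y j - w i)) * (x - y j)⁻¹ := by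
    refine Finset.sum_congr rfl fun j _ => ?_
    rw [Finset.prod_eq_zero (f := fun i => y j - y i) (Finset.mem_univ j) (sub_self _)]
    ring
  rw [hsum] at h
  rw [Finset.prod_mul_distrib, Finset.prod_inv_distrib, ← div_eq_mul_inv, div_eq_iff hQ]
  linear_combination h

/-- A sum over `Perm (Fin (n + 1))` organised by the image of `0`. -/
lemma sum_perm_fin_succ {M : Type*} [AddCommMonoid M] {n : ℕ}
    (f : Equiv.Perm (Fin (n + 1)) → M) :
    ∑ σ, f σ = ∑ k : Fin (n + 1), ∑ e : Equiv.Perm (Fin n),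
      f (k.cycleRange.symm * Equiv.Perm.decomposeFin.symm (0, e)) := by
  rw [← Fintype.sum_prod_type']
  refine (Fintype.sum_bijective (fun p : Fin (n + 1) × Equiv.Perm (Fin n) =>
    p.1.cycleRange.symm * Equiv.Perm.decomposeFin.symm (0, p.2)) ?_ _ _ fun _ => rfl).symm
  rw [Fintype.bijective_iff_injective_and_card]
  constructor
  · rintro ⟨k, e⟩ ⟨l, e'⟩ h
    have hkl : k = l := by simpa using congrArg (fun σ : Equiv.Perm (Fin (n + 1)) => σ 0) h
    subst hkl
    simpa using h
  · simp [Fintype.card_perm, Nat.factorial_succ]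

section Antisymmetrizer

variable {K : Type*} [Field K]

/-- The rational function being antisymmetrized, over an arbitrary field. -/
def asTerm (q : K) {n : ℕ} (w y : Fin n → K) : K :=
  (∏ i, ∏ j, if i < j then q * w i - q⁻¹ * w j else 1) *
    ((∏ i, ∏ j, if i ≤ j then w j - y i else 1) *
      ∏ i, ∏ j, if j ≤ i then q * w j - q⁻¹ * y i else 1)⁻¹

lemma asTerm_succ (q : K) {n : ℕ} (w y : Fin (n + 1) → K) :
    asTerm q w y = (∏ j : Fin n, (q * w 0 - q⁻¹ * w j.succ)) * (∏ j, (w j - y 0))⁻¹ *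
      (∏ i, (q * w 0 - q⁻¹ * y i))⁻¹ * asTerm q (Fin.tail w) (Fin.tail y) := by
  simp only [asTerm, Fin.prod_univ_succ, Fin.succ_lt_succ_iff, Fin.succ_le_succ_iff,
    Fin.succ_pos, Fin.zero_le, Fin.not_lt_zero, Fin.tail, if_true, if_false,
    Fin.le_zero_iff, Fin.succ_ne_zero, Finset.prod_const_one, one_mul, mul_one,
    Finset.prod_mul_distrib, mul_inv]
  ring

/-- The `w`-dependent column obtained by splitting off one variable is a linear combination of the
columns of the matrix `1 / (h₁ h_q)`. -/
lemma prod_succAbove_mul_inv_eq_sum {q : K} (hq0 : q ≠ 0) (hq1 : q - q⁻¹ ≠ 0) {n : ℕ}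
    (w y : Fin (n + 1) → K) (hw : ∀ i, w i ≠ 0) (hy : Function.Injective y)
    (h₁ : ∀ i j, w i - y j ≠ 0) (h₂ : ∀ i j, q * w i - q⁻¹ * y j ≠ 0) (k : Fin (n + 1)) :
    (∏ j : Fin n, (q * w k - q⁻¹ * w (k.succAbove j))) * (∏ i, (q * w k - q⁻¹ * y i))⁻¹ =
      ∑ j, (-(Lagrange.nodalWeight Finset.univ y j * ∏ i, (y j - w i))) *
        (1 / ((w k - y j) * (q * w k - q⁻¹ * y j))) := by
  have hb : ∀ u, q * w k - q⁻¹ * u = q⁻¹ * (q ^ 2 * w k - u) := fun u => by field_simp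
  have hx : ∀ j, q ^ 2 * w k - y j ≠ 0 := fun j h => h₂ k j (by rw [hb, h, mul_zero])
  have e₁ := prod_sub_mul_inv_eq_one_add_sum w y hy (q ^ 2 * w k) fun j => sub_ne_zero.1 (hx j)
  have e₂ := prod_sub_mul_inv_eq_one_add_sum w y hy (w k) fun j => sub_ne_zero.1 (h₁ k j)
  rw [Finset.prod_eq_zero (Finset.mem_univ k) (by simp)] at e₂
  have hne : (q - q⁻¹) * w k ≠ 0 := mul_ne_zero hq1 (hw k)
  have hsplit : (q - q⁻¹) * w k * ((∏ j : Fin n, (q * w k - q⁻¹ * w (k.succAbove j))) *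
      (∏ i, (q * w k - q⁻¹ * y i))⁻¹) =
      ∏ j, (q ^ 2 * w k - w j) * (q ^ 2 * w k - y j)⁻¹ := by
    rw [← mul_assoc, sub_mul, ← Fin.prod_univ_succAbove (fun j => q * w k - q⁻¹ * w j) k,
      ← Finset.prod_inv_distrib, ← Finset.prod_mul_distrib]
    refine Finset.prod_congr rfl fun j _ => ?_
    rw [hb, hb, mul_inv, inv_inv]
    field_simp
  refine mul_left_cancel₀ hne ?_
  rw [hsplit, e₁, ← sub_zero (1 + _), e₂, add_sub_add_left_eq_sub, ← Finset.sum_sub_distrib,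
    Finset.mul_sum]
  refine Finset.sum_congr rfl fun j _ => ?_
  have := h₁ k j
  have := hx j
  rw [hb]
  field_simp
  ring

/-- The antisymmetrizer identity over an arbitrary field, at a point where no denominator
vanishes. -/
theorem sum_sign_mul_asTerm {q : K} (hq0 : q ≠ 0) (hq1 : q - q⁻¹ ≠ 0) {n : ℕ}
    (w y : Fin n → K) (hw : ∀ i, w i ≠ 0) (hy : Function.Injective y)
    (h₁ : ∀ i j, w i - y j ≠ 0) (h₂ : ∀ i j, q * w i - q⁻¹ * y j ≠ 0) :
    ∑ σ : Equiv.Perm (Fin n), ((Equiv.Perm.sign σ : ℤ) : K) * asTerm q (w ∘ σ) y =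
      Matrix.det (Matrix.of fun i j => 1 / ((w i - y j) * (q * w i - q⁻¹ * y j))) *
        (∏ i, ∏ j, if i < j then y j - y i else 1)⁻¹ := by
  induction n with
  | zero => simp [asTerm]
  | succ n ih =>
    set D : Matrix (Fin (n + 1)) (Fin (n + 1)) K :=
      Matrix.of fun i j => 1 / ((w i - y j) * (q * w i - q⁻¹ * y j)) with hD
    set μ : Fin (n + 1) → K :=
      fun j => -(Lagrange.nodalWeight Finset.univ y j * ∏ i, (y j - w i)) with hμ
    set A : K := (∏ j, (w j - y 0))⁻¹ with hA
    set V : K := (∏ i : Fin n, ∏ j : Fin n, if i < j then y j.succ - y i.succ else 1)⁻¹ with hV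
    have hterm : ∀ (k : Fin (n + 1)) (e : Equiv.Perm (Fin n)),
        asTerm q (w ∘ (k.cycleRange.symm * Equiv.Perm.decomposeFin.symm (0, e) :
          Equiv.Perm (Fin (n + 1)))) y =
        A * (∑ j, μ j * D k j) * asTerm q ((w ∘ k.succAbove) ∘ e) (Fin.tail y) := by
      intro k e
      have hA' := Equiv.prod_comp (k.cycleRange.symm * Equiv.Perm.decomposeFin.symm (0, e) :
          Equiv.Perm (Fin (n + 1))) (fun j => w j - y 0)
      have hB := Equiv.prod_comp e (fun j => q * w k - q⁻¹ * w (k.succAbove j))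
      have hc := prod_succAbove_mul_inv_eq_sum hq0 hq1 w y hw hy h₁ h₂ k
      have ht : Fin.tail (w ∘ (k.cycleRange.symm * Equiv.Perm.decomposeFin.symm (0, e) :
          Equiv.Perm (Fin (n + 1)))) = (w ∘ k.succAbove) ∘ e := by
        funext i
        simp [Fin.tail]
      rw [asTerm_succ, ht]
      simp only [Function.comp_apply, hA']
      simp only [Equiv.Perm.mul_apply, Equiv.Perm.decomposeFin_symm_apply_zero,
        Equiv.Perm.decomposeFin_symm_apply_succ, Equiv.swap_self, Equiv.refl_apply,
        Fin.cycleRange_symm_zero, Fin.cycleRange_symm_succ, hB]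
      simp only [hD, Matrix.of_apply, hμ, ← hc]
      ring
    have hinner : ∀ k : Fin (n + 1), ∑ e : Equiv.Perm (Fin n),
        ((Equiv.Perm.sign e : ℤ) : K) * asTerm q ((w ∘ k.succAbove) ∘ e) (Fin.tail y) =
        (D.submatrix k.succAbove Fin.succ).det * V := fun k =>
      ih (w ∘ k.succAbove) (Fin.tail y) (fun _ => hw _)
        (hy.comp (Fin.succ_injective n)) (fun _ _ => h₁ _ _) fun _ _ => h₂ _ _
    have hdet : ∑ k : Fin (n + 1), (-1) ^ (k : ℕ) * (∑ j, μ j * D k j) *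
        (D.submatrix k.succAbove Fin.succ).det = μ 0 * D.det := by
      have h := Matrix.det_updateCol_sum D 0 μ
      rw [Matrix.det_succ_column_zero] at h
      simp only [smul_eq_mul] at h
      rw [← h]
      refine Finset.sum_congr rfl fun k _ => ?_
      congr 2
    have hμ0 : μ 0 * A * V = (∏ i, ∏ j, if i < j then y j - y i else 1)⁻¹ := by
      have hA0 : ∏ j, (w j - y 0) ≠ 0 := Finset.prod_ne_zero_iff.2 fun j _ => h₁ j 0
      have hweight : Lagrange.nodalWeight Finset.univ y 0 =
          (-1) ^ n * (∏ j : Fin n, (y j.succ - y 0))⁻¹ := by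
        rw [Lagrange.nodalWeight, ← Finset.prod_inv_distrib,
          show Finset.univ.erase (0 : Fin (n + 1)) = Finset.univ.map (Fin.succEmb n)
            by ext i; cases i using Fin.cases <;> simp, Finset.prod_map]
        trans ∏ j : Fin n, (-1) * (y j.succ - y 0)⁻¹
        · refine Finset.prod_congr rfl fun j _ => ?_
          rw [Fin.coe_succEmb, ← neg_sub (y j.succ), inv_neg, neg_one_mul]
        · rw [Finset.prod_mul_distrib, Finset.prod_inv_distrib]
          simp
      have hprod : ∏ i, (y 0 - w i) = (-1) ^ (n + 1) * ∏ i, (w i - y 0) := by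
        rw [Finset.prod_congr rfl fun i _ => (neg_one_mul (w i - y 0)).trans (neg_sub _ _) |>.symm,
          Finset.prod_mul_distrib]
        simp
      have hsq : ((-1 : K) ^ n) ^ 2 = 1 := by rw [← pow_mul, mul_comm, pow_mul]; simp
      have hsplit : (∏ i, ∏ j, if i < j then y j - y i else 1) =
          (∏ j : Fin n, (y j.succ - y 0)) *
            ∏ i : Fin n, ∏ j : Fin n, if i < j then y j.succ - y i.succ else 1 := by
        simp [Fin.prod_univ_succ]
      rw [hsplit, mul_inv, ← hV]
      trans ((-1) ^ n) ^ 2 * ((∏ j, (w j - y 0)) * A) * ((∏ j : Fin n, (y j.succ - y 0))⁻¹ * V)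
      · simp only [hμ, hweight, hprod]
        ring
      · rw [hsq, mul_inv_cancel₀ hA0, one_mul, one_mul]
    calc _ = ∑ k : Fin (n + 1), (-1) ^ (k : ℕ) * (A * (∑ j, μ j * D k j)) *
          ∑ e : Equiv.Perm (Fin n), ((Equiv.Perm.sign e : ℤ) : K) *
            asTerm q ((w ∘ k.succAbove) ∘ e) (Fin.tail y) := by
          rw [sum_perm_fin_succ]
          refine Finset.sum_congr rfl fun k _ => ?_
          rw [Finset.mul_sum]
          refine Finset.sum_congr rfl fun e _ => ?_
          rw [hterm]
          simp [Fin.sign_cycleRange, Equiv.Perm.decomposeFin.symm_sign]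
          ring
      _ = (∑ k : Fin (n + 1), (-1) ^ (k : ℕ) * (∑ j, μ j * D k j) *
          (D.submatrix k.succAbove Fin.succ).det) * (A * V) := by
          rw [Finset.sum_mul]
          refine Finset.sum_congr rfl fun k _ => ?_
          rw [hinner]
          ring
      _ = _ := by
          rw [hdet, ← hμ0]
          ring

end Antisymmetrizer

lemma algebraMap_RF_ne {n : ℕ} {p r : MvPolynomial (Fin n ⊕ Fin n ⊕ Unit) ℚ}
    (v : Fin n ⊕ Fin n ⊕ Unit → ℚ) (h : MvPolynomial.eval v p ≠ MvPolynomial.eval v r) :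
    algebraMap _ (RF n) p ≠ algebraMap _ (RF n) r := fun e =>
  h (congrArg _ (IsFractionRing.injective _ (RF n) e))

/-- The antisymmetrizer with respect to `w_1,…,w_n` of
`∏_{1≤i<j≤n} h_q(w_i,w_j) / (∏_{1≤i≤j≤n} h_1(w_j,y_i) ∏_{1≤j≤i≤n} h_q(w_j,y_i))`
equals `det_{1≤i,j≤n}(1/(h_1(w_i,y_j) h_q(w_i,y_j))) / ∏_{1≤i<j≤n} h_1(y_j,y_i)`. -/
theorem stmt17 (n : ℕ) (hn : 1 ≤ n) :
    (∑ σ : Equiv.Perm (Fin n), ((Equiv.Perm.sign σ : ℤ) : RF n) *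
      ((∏ p ∈ Finset.univ.filter (fun p : Fin n × Fin n => p.1 < p.2),
          hq (wv (σ p.1)) (wv (σ p.2))) /
        ((∏ p ∈ Finset.univ.filter (fun p : Fin n × Fin n => p.1 ≤ p.2),
            h1 (wv (σ p.2)) (yv p.1)) *
          ∏ p ∈ Finset.univ.filter (fun p : Fin n × Fin n => p.2 ≤ p.1),
            hq (wv (σ p.2)) (yv p.1)))) =
    Matrix.det (Matrix.of fun i j : Fin n => 1 / (h1 (wv i) (yv j) * hq (wv i) (yv j))) /
      ∏ p ∈ Finset.univ.filter (fun p : Fin n × Fin n => p.1 < p.2),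
        h1 (yv p.2) (yv p.1) := by
  have hq0 : (qv : RF n) ≠ 0 := by
    rw [qv, ← map_zero (algebraMap (MvPolynomial (Fin n ⊕ Fin n ⊕ Unit) ℚ) (RF n))]
    exact algebraMap_RF_ne (fun _ => 1) (by simp)
  have hq2 : (qv : RF n) ^ 2 ≠ 1 := by
    rw [qv, ← map_one (algebraMap (MvPolynomial (Fin n ⊕ Fin n ⊕ Unit) ℚ) (RF n)), ← map_pow]
    exact algebraMap_RF_ne (fun _ => 2) (by norm_num)
  have hq1 : (qv : RF n) - qv⁻¹ ≠ 0 := fun h => hq2 (by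
    field_simp at h
    linear_combination h)
  have hw : ∀ i, (wv i : RF n) ≠ 0 := fun i => by
    rw [wv, ← map_zero (algebraMap (MvPolynomial (Fin n ⊕ Fin n ⊕ Unit) ℚ) (RF n))]
    exact algebraMap_RF_ne (fun _ => 1) (by simp)
  have hy : Function.Injective (yv : Fin n → RF n) := fun i j h => by
    simpa using MvPolynomial.X_injective (IsFractionRing.injective _ (RF n) h)
  have h₁ : ∀ i j, (wv i : RF n) - yv j ≠ 0 := fun i j => sub_ne_zero.2 <|
    algebraMap_RF_ne (Sum.elim (fun _ => 1) fun _ => 0) (by simp)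
  have h₂ : ∀ i j, (qv : RF n) * wv i - qv⁻¹ * yv j ≠ 0 := fun i j h => by
    have h' : (qv : RF n) ^ 2 * wv i = yv j := by
      field_simp at h
      linear_combination h
    rw [qv, wv, yv, ← map_pow, ← map_mul] at h'
    exact algebraMap_RF_ne (Sum.elim (fun _ => 1) (Sum.elim (fun _ => 0) fun _ => 1))
      (by simp) h'
  have key := sum_sign_mul_asTerm hq0 hq1 (wv : Fin n → RF n) yv hw hy h₁ h₂
  simpa only [asTerm, hq, h1, Function.comp_apply, Finset.prod_filter, Fintype.prod_prod_type,
    div_eq_mul_inv] using key
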